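/- Let ρ_{AB₁B₂B'} be a purification of ρ_{AB₁B₂} (a pure state on H_A⊗H_{B₁}⊗H_{B₂}⊗H_{B'} whose partial trace over B' equals ρ_{AB₁B₂}). Then one has the exact identity S(R|AB₁)_κ + S(A|B₂B')_ω = S(R)_κ + D(κ_{AB₁} ‖ ω_{AB₁}), where ω is now the pinched version of the purified state; consequently by strong subadditivity S(R|AB₁)_κ + S(A|B₂)_ω ≥ S(R)_κ + D(κ_{AB₁} ‖ ω_{AB₁}), with equality if and only if I(A:B'|B₂)_ω = 0. -/

import Mathlib

open scoped Kronecker Classical ComplexOrder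
open Matrix

noncomputable section

/-- The rank-one projector `|v⟩⟨v|`. -/
def proj {α : Type*} (v : α → ℂ) : Matrix α α ℂ := Matrix.vecMulVec v (star v)

/-- Matrix logarithm of a Hermitian matrix, via the spectral decomposition
(junk value `0` on non-Hermitian matrices; eigenvalue `0` contributes `log 0 = 0`). -/
def mlog {n : Type*} [Fintype n] [DecidableEq n] (ρ : Matrix n n ℂ) : Matrix n n ℂ :=
  if h : ρ.IsHermitian then
    (h.eigenvectorUnitary : Matrix n n ℂ) *
      Matrix.diagonal (fun i => (Real.log (h.eigenvalues i) : ℂ)) *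
      (h.eigenvectorUnitary : Matrix n n ℂ)ᴴ
  else 0

/-- Von Neumann entropy `S(ρ) = -Tr ρ log ρ`. -/
def vN {n : Type*} [Fintype n] [DecidableEq n] (ρ : Matrix n n ℂ) : ℝ :=
  -(Matrix.trace (ρ * mlog ρ)).re

/-- Quantum relative entropy `D(ρ‖σ) = Tr ρ (log ρ - log σ)`. -/
def relent {n : Type*} [Fintype n] [DecidableEq n] (ρ σ : Matrix n n ℂ) : ℝ :=
  (Matrix.trace (ρ * (mlog ρ - mlog σ))).re

/-- The rotation `e^{-iGr}` generated by the Hermitian operator `G` with orthonormal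
eigenbasis `g` and eigenvalues `gv`. -/
def Urot {iA : Type*} [Fintype iA] (g : iA → iA → ℂ) (gv : iA → ℝ) (r : ℝ) : Matrix iA iA ℂ :=
  ∑ l, Complex.exp (-(Complex.I) * (gv l) * r) • proj (g l)

section Tripartite

variable {iR iA iB1 iB2 : Type*} [Fintype iR] [Fintype iA] [Fintype iB1] [Fintype iB2]
  [DecidableEq iR] [DecidableEq iA] [DecidableEq iB1] [DecidableEq iB2]

/-- `e^{-iGr} ⊗ I_{B₁} ⊗ I_{B₂}`. -/
def UA3
    (g : iA → iA → ℂ) (gv : iA → ℝ) (r : ℝ) :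
    Matrix ((iA × iB1) × iB2) ((iA × iB1) × iB2) ℂ :=
  (Urot g gv r ⊗ₖ (1 : Matrix iB1 iB1 ℂ)) ⊗ₖ (1 : Matrix iB2 iB2 ℂ)

/-- `κ_{RAB₁B₂} = Σ_k p_k |r_k⟩⟨r_k| ⊗ (e^{-iGr_k}⊗I) ρ (e^{iGr_k}⊗I)`. -/
def kappa3
    (p : iR → ℝ) (rb : iR → iR → ℂ) (rv : iR → ℝ) (g : iA → iA → ℂ) (gv : iA → ℝ)
    (ρ : Matrix ((iA × iB1) × iB2) ((iA × iB1) × iB2) ℂ) :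
    Matrix (iR × ((iA × iB1) × iB2)) (iR × ((iA × iB1) × iB2)) ℂ :=
  ∑ k, (p k : ℂ) • (proj (rb k) ⊗ₖ (UA3 g gv (rv k) * ρ * (UA3 g gv (rv k))ᴴ))

/-- `ω_{AB₁B₂} = Σ_l (|g_l⟩⟨g_l|⊗I) ρ (|g_l⟩⟨g_l|⊗I)`. -/
def omega3 
    (g : iA → iA → ℂ)
    (ρ : Matrix ((iA × iB1) × iB2) ((iA × iB1) × iB2) ℂ) :
    Matrix ((iA × iB1) × iB2) ((iA × iB1) × iB2) ℂ :=
  ∑ l, ((proj (g l) ⊗ₖ (1 : Matrix iB1 iB1 ℂ)) ⊗ₖ (1 : Matrix iB2 iB2 ℂ)) * ρ *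
       ((proj (g l) ⊗ₖ (1 : Matrix iB1 iB1 ℂ)) ⊗ₖ (1 : Matrix iB2 iB2 ℂ))

/-- Reduced state on `RAB₁` of a state on `RAB₁B₂`. -/
def redRAB1 
    (τ : Matrix (iR × ((iA × iB1) × iB2)) (iR × ((iA × iB1) × iB2)) ℂ) :
    Matrix (iR × (iA × iB1)) (iR × (iA × iB1)) ℂ :=
  Matrix.of fun x y => ∑ k : iB2, τ (x.1, (x.2, k)) (y.1, (y.2, k))

/-- Reduced state on `AB₁` of a state on `RAB₁B₂`. -/
def redAB1four 
    (τ : Matrix (iR × ((iA × iB1) × iB2)) (iR × ((iA × iB1) × iB2)) ℂ) :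
    Matrix (iA × iB1) (iA × iB1) ℂ :=
  Matrix.of fun x y => ∑ k : iR, ∑ m : iB2, τ (k, (x, m)) (k, (y, m))

/-- Reduced state on `R` of a state on `RAB₁B₂`. -/
def redRfour 
    (τ : Matrix (iR × ((iA × iB1) × iB2)) (iR × ((iA × iB1) × iB2)) ℂ) :
    Matrix iR iR ℂ :=
  Matrix.of fun i j => ∑ x : (iA × iB1) × iB2, τ (i, x) (j, x)

/-- Reduced state on `AB₁` of a state on `AB₁B₂`. -/
def redAB1 
    (σ : Matrix ((iA × iB1) × iB2) ((iA × iB1) × iB2) ℂ) :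
    Matrix (iA × iB1) (iA × iB1) ℂ :=
  Matrix.of fun x y => ∑ k : iB2, σ (x, k) (y, k)

/-- Reduced state on `AB₂` of a state on `AB₁B₂`. -/
def redAB2 
    (σ : Matrix ((iA × iB1) × iB2) ((iA × iB1) × iB2) ℂ) :
    Matrix (iA × iB2) (iA × iB2) ℂ :=
  Matrix.of fun x y => ∑ m : iB1, σ ((x.1, m), x.2) ((y.1, m), y.2)

/-- Reduced state on `B₂` of a state on `AB₁B₂`. -/
def redB2 
    (σ : Matrix ((iA × iB1) × iB2) ((iA × iB1) × iB2) ℂ) :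
    Matrix iB2 iB2 ℂ :=
  Matrix.of fun i j => ∑ x : iA × iB1, σ (x, i) (x, j)

/-- Reduced state on `A` of a state on `AB₁B₂`. -/
def redA3 
    (σ : Matrix ((iA × iB1) × iB2) ((iA × iB1) × iB2) ℂ) :
    Matrix iA iA ℂ :=
  Matrix.of fun i j => ∑ m : iB1, ∑ k : iB2, σ ((i, m), k) ((j, m), k)

/-- Reduced state on `B₁` of a state on `AB₁B₂`. -/
def redB1 
    (σ : Matrix ((iA × iB1) × iB2) ((iA × iB1) × iB2) ℂ) :
    Matrix iB1 iB1 ℂ :=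
  Matrix.of fun i j => ∑ a : iA, ∑ k : iB2, σ ((a, i), k) ((a, j), k)

/-- Reduced state on `B₁B₂` of a state on `AB₁B₂`. -/
def redB1B2 
    (σ : Matrix ((iA × iB1) × iB2) ((iA × iB1) × iB2) ℂ) :
    Matrix (iB1 × iB2) (iB1 × iB2) ℂ :=
  Matrix.of fun x y => ∑ a : iA, σ ((a, x.1), x.2) ((a, y.1), y.2)

end Tripartite

section Purified

variable {iR iA iB1 iB2 iBp : Type*}
  [Fintype iR] [Fintype iA] [Fintype iB1] [Fintype iB2] [Fintype iBp]
  [DecidableEq iR] [DecidableEq iA] [DecidableEq iB1] [DecidableEq iB2] [DecidableEq iBp]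

/-- `ω` for the purified state: `Σ_l (|g_l⟩⟨g_l|⊗I⊗I⊗I) ρ_{AB₁B₂B'} (|g_l⟩⟨g_l|⊗I⊗I⊗I)`. -/
def omega4 (g : iA → iA → ℂ)
    (τ : Matrix ((((iA × iB1) × iB2) × iBp)) ((((iA × iB1) × iB2) × iBp)) ℂ) :
    Matrix ((((iA × iB1) × iB2) × iBp)) ((((iA × iB1) × iB2) × iBp)) ℂ :=
  ∑ l, (((proj (g l) ⊗ₖ (1 : Matrix iB1 iB1 ℂ)) ⊗ₖ (1 : Matrix iB2 iB2 ℂ)) ⊗ₖ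
          (1 : Matrix iBp iBp ℂ)) * τ *
       (((proj (g l) ⊗ₖ (1 : Matrix iB1 iB1 ℂ)) ⊗ₖ (1 : Matrix iB2 iB2 ℂ)) ⊗ₖ
          (1 : Matrix iBp iBp ℂ))

/-- Reduced state on `AB₁B₂` of a state on `AB₁B₂B'`. -/
def redABB (σ : Matrix ((((iA × iB1) × iB2) × iBp)) ((((iA × iB1) × iB2) × iBp)) ℂ) :
    Matrix ((iA × iB1) × iB2) ((iA × iB1) × iB2) ℂ :=
  Matrix.of fun x y => ∑ m : iBp, σ (x, m) (y, m)

/-- Reduced state on `AB₁` of a state on `AB₁B₂B'`. -/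
def redAB1p (σ : Matrix ((((iA × iB1) × iB2) × iBp)) ((((iA × iB1) × iB2) × iBp)) ℂ) :
    Matrix (iA × iB1) (iA × iB1) ℂ :=
  Matrix.of fun x y => ∑ k : iB2, ∑ m : iBp, σ ((x, k), m) ((y, k), m)

/-- Reduced state on `AB₂B'` of a state on `AB₁B₂B'`. -/
def redAB2Bp (σ : Matrix ((((iA × iB1) × iB2) × iBp)) ((((iA × iB1) × iB2) × iBp)) ℂ) :
    Matrix ((iA × iB2) × iBp) ((iA × iB2) × iBp) ℂ :=
  Matrix.of fun x y => ∑ m : iB1,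
    σ (((x.1.1, m), x.1.2), x.2) (((y.1.1, m), y.1.2), y.2)

/-- Reduced state on `B₂B'` of a state on `AB₁B₂B'`. -/
def redB2Bp (σ : Matrix ((((iA × iB1) × iB2) × iBp)) ((((iA × iB1) × iB2) × iBp)) ℂ) :
    Matrix (iB2 × iBp) (iB2 × iBp) ℂ :=
  Matrix.of fun x y => ∑ a : iA × iB1, σ ((a, x.1), x.2) ((a, y.1), y.2)

/-- Reduced state on `AB₂` of a state on `AB₁B₂B'`. -/
def redAB2p (σ : Matrix ((((iA × iB1) × iB2) × iBp)) ((((iA × iB1) × iB2) × iBp)) ℂ) :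
    Matrix (iA × iB2) (iA × iB2) ℂ :=
  Matrix.of fun x y => ∑ m : iB1, ∑ mp : iBp,
    σ (((x.1, m), x.2), mp) (((y.1, m), y.2), mp)

/-- Reduced state on `B₂` of a state on `AB₁B₂B'`. -/
def redB2p (σ : Matrix ((((iA × iB1) × iB2) × iBp)) ((((iA × iB1) × iB2) × iBp)) ℂ) :
    Matrix iB2 iB2 ℂ :=
  Matrix.of fun i j => ∑ a : iA × iB1, ∑ m : iBp, σ ((a, i), m) ((a, j), m)

end Purified


/-! ### Spectral preliminaries -/

theorem aux_spec {n : Type*} [Fintype n] [DecidableEq n] (M : Matrix n n ℂ) (hM : M.IsHermitian) :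
    ∃ (V : Matrix n n ℂ) (d : n → ℝ), Vᴴ * V = 1 ∧ V * Vᴴ = 1 ∧
      M = V * diagonal (fun i => (d i : ℂ)) * Vᴴ ∧
      mlog M = V * diagonal (fun i => (Real.log (d i) : ℂ)) * Vᴴ ∧
      (M.PosSemidef → ∀ i, 0 ≤ d i) ∧
      M.charpoly.roots = Multiset.map (fun i => (d i : ℂ)) Finset.univ.val := by
  refine ⟨(hM.eigenvectorUnitary : Matrix n n ℂ), hM.eigenvalues, ?_, ?_, ?_, ?_, ?_, ?_⟩
  · exact Unitary.coe_star_mul_self hM.eigenvectorUnitary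
  · exact Unitary.coe_mul_star_self hM.eigenvectorUnitary
  · have := hM.spectral_theorem
    rw [Unitary.conjStarAlgAut_apply] at this
    exact this
  · simp only [mlog, hM, dif_pos]
  · intro h i
    exact h.eigenvalues_nonneg i
  · exact hM.roots_charpoly_eq_eigenvalues

/-- entropy functional expressed through the characteristic polynomial -/
def auxF {n : Type*} [Fintype n] [DecidableEq n] (M : Matrix n n ℂ) : ℝ :=
  (M.charpoly.roots.map (fun z => Real.negMulLog z.re)).sum

theorem vN_eq_auxF {n : Type*} [Fintype n] [DecidableEq n] (M : Matrix n n ℂ)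
    (hM : M.IsHermitian) : vN M = auxF M := by
  obtain ⟨V, d, h1, h2, h3, h4, -, h6⟩ := aux_spec M hM
  have : M * mlog M = V * diagonal (fun i => (d i * Real.log (d i) : ℂ)) * Vᴴ := by
    rw [h4]
    nth_rewrite 1 [h3]
    calc _ = V * diagonal (fun i => (d i : ℂ)) * (Vᴴ * V) *
          diagonal (fun i => (Real.log (d i) : ℂ)) * Vᴴ := by simp only [Matrix.mul_assoc]
      _ = _ := by rw [h1, Matrix.mul_one, Matrix.mul_assoc V, diagonal_mul_diagonal]
  rw [vN, this, Matrix.trace_mul_comm, ← Matrix.mul_assoc, h1, Matrix.one_mul, auxF, h6,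
    Matrix.trace_diagonal]
  simp only [Multiset.map_map, Function.comp_def, Complex.ofReal_re, Complex.re_sum]
  simp only [← Complex.ofReal_mul, Complex.ofReal_re, Real.negMulLog]
  rw [← Finset.sum_neg_distrib]
  simp only [neg_mul]
  rfl

theorem auxF_mul_comm {n k : Type*} [Fintype n] [DecidableEq n] [Fintype k] [DecidableEq k]
    (A : Matrix n k ℂ) (B : Matrix k n ℂ) : auxF (A * B) = auxF (B * A) := by
  have h := congrArg Polynomial.roots (charpoly_mul_comm' A B)
  have hA : (A * B).charpoly ≠ 0 := (charpoly_monic _).ne_zero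
  have hB : (B * A).charpoly ≠ 0 := (charpoly_monic _).ne_zero
  rw [Polynomial.roots_mul (mul_ne_zero (pow_ne_zero _ Polynomial.X_ne_zero) hA),
    Polynomial.roots_mul (mul_ne_zero (pow_ne_zero _ Polynomial.X_ne_zero) hB),
    Polynomial.roots_X_pow, Polynomial.roots_X_pow] at h
  have h' := congrArg (fun s => (Multiset.map (fun z : ℂ => Real.negMulLog z.re) s).sum) h
  simpa [auxF, Multiset.map_nsmul, Multiset.sum_nsmul] using h'

theorem vN_of_isometry {n k : Type*} [Fintype n] [DecidableEq n] [Fintype k] [DecidableEq k]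
    (M : Matrix n n ℂ) (V : Matrix n k ℂ) (d : k → ℝ) (hV : Vᴴ * V = 1)
    (hM : M = V * diagonal (fun i => (d i : ℂ)) * Vᴴ) :
    vN M = ∑ i, Real.negMulLog (d i) := by
  have hH : M.IsHermitian := by
    rw [hM]
    apply Matrix.isHermitian_mul_mul_conjTranspose
    rw [Matrix.IsHermitian, diagonal_conjTranspose]
    congr 1
    ext i
    simp
  rw [vN_eq_auxF M hH, hM, Matrix.mul_assoc, auxF_mul_comm, Matrix.mul_assoc, hV, Matrix.mul_one,
    auxF, charpoly_diagonal, Polynomial.roots_prod _ _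
      (Finset.prod_ne_zero_iff.mpr fun i _ => Polynomial.X_sub_C_ne_zero _)]
  simp

theorem vN_purity {n k : Type*} [Fintype n] [DecidableEq n] [Fintype k] [DecidableEq k]
    (X : Matrix n k ℂ) : vN (X * Xᴴ) = vN (Xᵀ * (Xᵀ)ᴴ) := by
  rw [vN_eq_auxF _ (Matrix.isHermitian_mul_conjTranspose_self X),
    vN_eq_auxF _ (Matrix.isHermitian_mul_conjTranspose_self _), auxF_mul_comm]
  have : Xᵀ * (Xᵀ)ᴴ = (Xᴴ * X)ᵀ := by
    rw [Matrix.transpose_mul]; rfl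
  rw [this, auxF, auxF, charpoly_transpose]

theorem vN_cq {n a m : Type*} [Fintype n] [DecidableEq n] [Fintype a] [DecidableEq a]
    [Fintype m] [DecidableEq m] (e : n ≃ a × m) (g : a → a → ℂ)
    (hg : ∀ l m, star (g l) ⬝ᵥ g m = if l = m then 1 else 0)
    (σ : a → Matrix m m ℂ) (hσ : ∀ l, (σ l).IsHermitian) (M : Matrix n n ℂ)
    (hM : ∀ x y, M x y = ∑ l, g l (e x).1 * star (g l (e y).1) * σ l (e x).2 (e y).2) :
    vN M = ∑ l, vN (σ l) := by
  choose V d h1 h2 h3 h4 h5 h6 using fun l => aux_spec (σ l) (hσ l)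
  have hs : ∀ l, vN (σ l) = ∑ i, Real.negMulLog (d l i) :=
    fun l => vN_of_isometry _ (V l) (d l) (h1 l) (h3 l)
  simp_rw [hs]
  rw [← Fintype.sum_prod_type']
  apply vN_of_isometry M (Matrix.of fun x (q : a × m) => g q.1 (e x).1 * V q.1 (e x).2 q.2)
    (fun q => d q.1 q.2)
  · ext ⟨l, i⟩ ⟨l', j⟩
    rw [Matrix.mul_apply, ← e.symm.sum_comp, Fintype.sum_prod_type]
    simp only [conjTranspose_apply, of_apply, Equiv.apply_symm_apply, star_mul']
    have : ∀ x y, star (g l x) * star (V l y i) * (g l' x * V l' y j)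
        = (star (g l x) * g l' x) * (star (V l y i) * V l' y j) := by intros; ring
    simp_rw [this, ← Finset.mul_sum, ← Finset.sum_mul]
    have h := hg l l'
    simp only [dotProduct, Pi.star_apply] at h
    rw [h]
    by_cases hl : l = l'
    · subst hl
      have := congrFun (congrFun (h1 l) i) j
      simp only [Matrix.mul_apply, conjTranspose_apply] at this
      rw [this, if_pos rfl, one_mul, Matrix.one_apply, Matrix.one_apply]
      simp
    · simp [hl]
  · ext x y
    rw [hM, Matrix.mul_apply, Fintype.sum_prod_type]
    refine Finset.sum_congr rfl fun l _ => ?_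
    nth_rewrite 1 [h3 l]
    rw [Matrix.mul_apply, Finset.mul_sum]
    refine Finset.sum_congr rfl fun i _ => ?_
    simp only [Matrix.mul_diagonal, conjTranspose_apply, of_apply, star_mul']
    ring

theorem vN_smul_conj {n : Type*} [Fintype n] [DecidableEq n] (M U : Matrix n n ℂ)
    (hM : M.IsHermitian) (hU : Uᴴ * U = 1) (c : ℝ) :
    vN ((c : ℂ) • (U * M * Uᴴ)) = c * vN M + Real.negMulLog c * M.trace.re := by
  obtain ⟨V, d, h1, h2, h3, h4, -, h6⟩ := aux_spec M hM
  rw [vN_of_isometry M V d h1 h3]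
  rw [vN_of_isometry _ (U * V) (fun i => c * d i)]
  · have ht : M.trace.re = ∑ i, d i := by
      rw [h3, Matrix.trace_mul_comm, ← Matrix.mul_assoc, h1, Matrix.one_mul, trace_diagonal]
      simp
    rw [ht, Finset.mul_sum, Finset.mul_sum, ← Finset.sum_add_distrib]
    refine Finset.sum_congr rfl fun i _ => ?_
    rw [Real.negMulLog_mul]; ring
  · rw [conjTranspose_mul]
    calc _ = Vᴴ * (Uᴴ * U) * V := by simp only [Matrix.mul_assoc]
      _ = 1 := by rw [hU, Matrix.mul_one, h1]
  · have : diagonal (fun i => ((c * d i : ℝ) : ℂ)) = (c : ℂ) • diagonal (fun i => (d i : ℂ)) := by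
      rw [← diagonal_smul]; congr 1; ext i; simp
    rw [this]
    nth_rewrite 1 [h3]
    simp only [conjTranspose_mul, Matrix.mul_assoc, Matrix.smul_mul, Matrix.mul_smul]

theorem mlog_commute {n : Type*} [Fintype n] [DecidableEq n] (M P : Matrix n n ℂ)
    (hM : M.IsHermitian) (h : P * M = M * P) : P * mlog M = mlog M * P := by
  obtain ⟨V, d, h1, h2, h3, h4, -, h6⟩ := aux_spec M hM
  set Q := Vᴴ * P * V with hQ
  have hP : P = V * Q * Vᴴ := by
    rw [hQ]
    calc P = (V * Vᴴ) * P * (V * Vᴴ) := by rw [h2]; simp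
      _ = _ := by simp only [Matrix.mul_assoc]
  have key : ∀ f : n → ℂ, P * (V * diagonal f * Vᴴ) = V * (Q * diagonal f) * Vᴴ ∧
      (V * diagonal f * Vᴴ) * P = V * (diagonal f * Q) * Vᴴ := by
    intro f
    constructor
    · calc _ = V * Q * (Vᴴ * V) * diagonal f * Vᴴ := by rw [hP]; simp only [Matrix.mul_assoc]
        _ = _ := by rw [h1]; simp only [Matrix.mul_assoc, Matrix.one_mul]
    · calc _ = V * diagonal f * (Vᴴ * V) * Q * Vᴴ := by rw [hP]; simp only [Matrix.mul_assoc]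
        _ = _ := by rw [h1]; simp only [Matrix.mul_assoc, Matrix.one_mul]
  have hc : Q * diagonal (fun i => (d i : ℂ)) = diagonal (fun i => (d i : ℂ)) * Q := by
    have h' : V * (Q * diagonal (fun i => (d i : ℂ))) * Vᴴ =
        V * (diagonal (fun i => (d i : ℂ)) * Q) * Vᴴ := by
      rw [← (key _).1, ← (key _).2, ← h3, h]
    have h'' := congrArg (fun Z => Vᴴ * Z * V) h'
    have e : ∀ Z : Matrix n n ℂ, Vᴴ * (V * Z * Vᴴ) * V = Z := by
      intro Z
      calc _ = (Vᴴ * V) * Z * (Vᴴ * V) := by simp only [Matrix.mul_assoc]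
        _ = Z := by rw [h1]; simp
    simpa only [e] using h''
  have hl : Q * diagonal (fun i => (Real.log (d i) : ℂ)) =
      diagonal (fun i => (Real.log (d i) : ℂ)) * Q := by
    ext i j
    have := congrFun (congrFun hc i) j
    rw [mul_diagonal, diagonal_mul] at this ⊢
    by_cases hq : Q i j = 0
    · simp [hq]
    · rw [mul_comm] at this
      have := mul_right_cancel₀ hq this
      have : d j = d i := by exact_mod_cast this
      rw [this, mul_comm]
  rw [h4, (key _).1, (key _).2, hl]

/-! ### Monotonicity of relative entropy under partial trace -/

theorem aux_integral (a b : ℝ) (ha : 0 ≤ a) (hb : 0 ≤ b) (hab : b = 0 → a = 0) :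
    IntervalIntegrable (fun u : ℝ => (1 - u) * ((a - b) ^ 2 / (u * a + (1 - u) * b)))
      MeasureTheory.volume 0 1 ∧
    ∫ u in (0 : ℝ)..1, (1 - u) * ((a - b) ^ 2 / (u * a + (1 - u) * b))
      = a * (Real.log a - Real.log b) - a + b := by
  rcases eq_or_lt_of_le hb with hb0 | hb0
  · have := hab hb0.symm
    subst this
    subst hb0
    simp
  rcases eq_or_lt_of_le ha with ha0 | ha0
  · subst ha0
    have hae : (fun _ : ℝ => b) =ᵐ[MeasureTheory.volume.restrict (Set.uIoc 0 1)]
        (fun u : ℝ => (1 - u) * ((0 - b) ^ 2 / (u * 0 + (1 - u) * b))) := by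
      have h1 : ∀ᵐ u : ℝ ∂(MeasureTheory.volume.restrict (Set.uIoc 0 1)), u ≠ 1 := by
        apply MeasureTheory.ae_restrict_of_ae
        simp [MeasureTheory.ae_iff]
      filter_upwards [h1] with u hu
      have : 1 - u ≠ 0 := sub_ne_zero.mpr (Ne.symm hu)
      field_simp
      ring
    constructor
    · exact (intervalIntegrable_const (c := b)).congr_ae hae
    · rw [← intervalIntegral.integral_congr_ae_restrict hae]
      simp
  have hD : ∀ u ∈ Set.uIcc (0 : ℝ) 1, 0 < u * a + (1 - u) * b := by
    intro u hu
    rw [Set.uIcc_of_le zero_le_one] at hu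
    rcases eq_or_lt_of_le hu.1 with h | h
    · rw [← h]; simpa using hb0
    · have := mul_pos h ha0
      have := mul_nonneg (sub_nonneg.mpr hu.2) hb
      linarith
  have hint : IntervalIntegrable (fun u : ℝ => (1 - u) * ((a - b) ^ 2 / (u * a + (1 - u) * b)))
      MeasureTheory.volume 0 1 := by
    apply ContinuousOn.intervalIntegrable
    apply ContinuousOn.mul (by fun_prop)
    apply ContinuousOn.div (by fun_prop) (by fun_prop)
    intro u hu
    exact (hD u hu).ne'
  refine ⟨hint, ?_⟩
  have hder : ∀ u ∈ Set.uIcc (0 : ℝ) 1,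
      HasDerivAt (fun u : ℝ => a * Real.log (u * a + (1 - u) * b) - (a - b) * u)
        ((1 - u) * ((a - b) ^ 2 / (u * a + (1 - u) * b))) u := by
    intro u hu
    have hd := (hD u hu).ne'
    have h1 : HasDerivAt (fun u : ℝ => u * a + (1 - u) * b) (1 * a + (0 - 1) * b) u :=
      ((hasDerivAt_id u).mul_const a).add
        ((((hasDerivAt_const u (1 : ℝ)).sub (hasDerivAt_id u))).mul_const b)
    have h2 := ((h1.log hd).const_mul a).sub ((hasDerivAt_id u).const_mul (a - b))
    have e : (1 - u) * ((a - b) ^ 2 / (u * a + (1 - u) * b)) =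
        a * ((1 * a + (0 - 1) * b) / (u * a + (1 - u) * b)) - (a - b) * 1 := by
      field_simp
      ring
    rw [e]
    exact h2
  rw [intervalIntegral.integral_eq_sub_of_hasDerivAt hder hint]
  simp
  ring

/-- variational functional -/
def auxJ {n : Type*} [Fintype n] (ρ σ : Matrix n n ℂ) (u : ℝ) (Y : Matrix n n ℂ) : ℝ :=
  2 * (Matrix.trace (Yᴴ * (ρ - σ))).re - u * (Matrix.trace (Yᴴ * ρ * Y)).re
    - (1 - u) * (Matrix.trace (Y * σ * Yᴴ)).re

theorem auxJ_eq {n : Type*} [Fintype n] [DecidableEq n] (V W Z : Matrix n n ℂ) (a b : n → ℝ)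
    (hV : Vᴴ * V = 1) (hW : Wᴴ * W = 1) (u : ℝ) :
    auxJ (V * diagonal (fun i => (a i : ℂ)) * Vᴴ) (W * diagonal (fun i => (b i : ℂ)) * Wᴴ) u
      (V * Z * Wᴴ) = ∑ i, ∑ j, (2 * ((a i - b j) * (star (Z i j) * (Vᴴ * W) i j).re)
        - (u * a i + (1 - u) * b j) * Complex.normSq (Z i j)) := by
  set D := Vᴴ * W with hD
  set A := diagonal (fun i => (a i : ℂ)) with hA
  set B := diagonal (fun i => (b i : ℂ)) with hB
  have e1 : Matrix.trace ((V * Z * Wᴴ)ᴴ * (V * A * Vᴴ - W * B * Wᴴ))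
      = Matrix.trace (Zᴴ * (A * D - D * B)) := by
    simp only [conjTranspose_mul, conjTranspose_conjTranspose]
    rw [Matrix.mul_assoc W, Matrix.mul_assoc W, Matrix.trace_mul_comm]
    congr 1
    calc _ = Zᴴ * ((Vᴴ * V) * A * (Vᴴ * W) - (Vᴴ * W) * B * (Wᴴ * W)) := by
          simp only [Matrix.mul_sub, Matrix.sub_mul, Matrix.mul_assoc]
      _ = _ := by rw [hV, hW, ← hD]; simp
  have e2 : Matrix.trace ((V * Z * Wᴴ)ᴴ * (V * A * Vᴴ) * (V * Z * Wᴴ))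
      = Matrix.trace (Zᴴ * (A * Z)) := by
    simp only [conjTranspose_mul, conjTranspose_conjTranspose]
    rw [Matrix.trace_mul_comm]
    calc _ = Matrix.trace (V * (Z * (Wᴴ * W) * (Zᴴ * (Vᴴ * V) * A) * Vᴴ)) := by
          simp only [Matrix.mul_assoc]
      _ = Matrix.trace ((Z * (Wᴴ * W) * (Zᴴ * (Vᴴ * V) * A) * (Vᴴ * V))) := by
          rw [Matrix.trace_mul_comm]; simp only [Matrix.mul_assoc]
      _ = _ := by
          rw [hV, hW, Matrix.mul_one, Matrix.mul_one, Matrix.mul_one, Matrix.trace_mul_comm,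
            Matrix.mul_assoc]
  have e3 : Matrix.trace ((V * Z * Wᴴ) * (W * B * Wᴴ) * (V * Z * Wᴴ)ᴴ)
      = Matrix.trace (Zᴴ * (Z * B)) := by
    simp only [conjTranspose_mul, conjTranspose_conjTranspose]
    rw [Matrix.trace_mul_comm]
    calc _ = Matrix.trace (W * (Zᴴ * (Vᴴ * V) * (Z * (Wᴴ * W) * B) * Wᴴ)) := by
          simp only [Matrix.mul_assoc]
      _ = Matrix.trace (Zᴴ * (Vᴴ * V) * (Z * (Wᴴ * W) * B) * (Wᴴ * W)) := by
          rw [Matrix.trace_mul_comm]; simp only [Matrix.mul_assoc]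
      _ = _ := by
          rw [hV, hW, Matrix.mul_one, Matrix.mul_one, Matrix.mul_one]
  have tr : ∀ X : Matrix n n ℂ, Matrix.trace (Zᴴ * X) = ∑ i, ∑ j, star (Z i j) * X i j := by
    intro X
    simp only [Matrix.trace, Matrix.diag, Matrix.mul_apply, conjTranspose_apply]
    rw [Finset.sum_comm]
  rw [auxJ, e1, e2, e3, tr, tr, tr]
  simp only [Complex.re_sum, Finset.mul_sum, ← Finset.sum_sub_distrib]
  refine Finset.sum_congr rfl fun i _ => Finset.sum_congr rfl fun j _ => ?_
  simp only [hA, hB, Matrix.sub_apply, diagonal_mul, mul_diagonal]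
  simp [Complex.normSq_apply]
  ring

theorem aux_quad (z w : ℂ) (t d : ℝ) (hd : 0 ≤ d) (hdt : d = 0 → t = 0) :
    2 * (t * (star z * w).re) - d * Complex.normSq z ≤ Complex.normSq w * (t ^ 2 / d) := by
  rcases eq_or_lt_of_le hd with h | h
  · rw [hdt h.symm, ← h]; simp
  · have e : Complex.normSq w * (t ^ 2 / d) -
        (2 * (t * (star z * w).re) - d * Complex.normSq z)
        = ((d * z.re - t * w.re) ^ 2 + (d * z.im - t * w.im) ^ 2) / d := by
      simp [Complex.normSq_apply]
      field_simp
      ring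
    have : 0 ≤ ((d * z.re - t * w.re) ^ 2 + (d * z.im - t * w.im) ^ 2) / d := by positivity
    linarith

theorem aux_quad_eq (w : ℂ) (t d : ℝ) :
    2 * (t * (star (((t / d : ℝ) : ℂ) * w) * w).re) - d * Complex.normSq (((t / d : ℝ) : ℂ) * w)
      = Complex.normSq w * (t ^ 2 / d) := by
  rcases eq_or_ne d 0 with h | h
  · rw [h]; simp
  · simp [Complex.normSq_apply, -Complex.ofReal_div]
    field_simp
    ring

theorem relent_rep {n : Type*} [Fintype n] [DecidableEq n] (ρ σ : Matrix n n ℂ)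
    (hρ : ρ.PosSemidef) (hσ : σ.PosSemidef) (hle : (σ - ρ).PosSemidef) :
    ∃ Q : ℝ → ℝ, IntervalIntegrable (fun u => (1 - u) * Q u) MeasureTheory.volume 0 1 ∧
      relent ρ σ = (ρ.trace - σ.trace).re + ∫ u in (0 : ℝ)..1, (1 - u) * Q u ∧
      ∀ u, 0 < u → u < 1 → (∀ Y, auxJ ρ σ u Y ≤ Q u) ∧ ∃ Y, auxJ ρ σ u Y = Q u := by
  obtain ⟨V, a, V1, V2, V3, V4, V5, -⟩ := aux_spec ρ hρ.1
  obtain ⟨W, b, W1, W2, W3, W4, W5, -⟩ := aux_spec σ hσ.1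
  have ha := V5 hρ
  have hb := W5 hσ
  set D := Vᴴ * W with hD
  have D1 : Dᴴ * D = 1 := by
    rw [hD, conjTranspose_mul, conjTranspose_conjTranspose]
    calc _ = Wᴴ * (V * Vᴴ) * W := by simp only [Matrix.mul_assoc]
      _ = 1 := by rw [V2, Matrix.mul_one, W1]
  have D2 : D * Dᴴ = 1 := by
    rw [hD, conjTranspose_mul, conjTranspose_conjTranspose]
    calc _ = Vᴴ * (W * Wᴴ) * V := by simp only [Matrix.mul_assoc]
      _ = 1 := by rw [W2, Matrix.mul_one, V1]
  set c : n → n → ℝ := fun i j => Complex.normSq (D i j) with hc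
  have hcol : ∀ j, ∑ i, c i j = 1 := by
    intro j
    have := congrArg Complex.re (congrFun (congrFun D1 j) j)
    simpa [Matrix.mul_apply, hc, Complex.normSq_apply] using this
  have hrow : ∀ i, ∑ j, c i j = 1 := by
    intro i
    have := congrArg Complex.re (congrFun (congrFun D2 i) i)
    simpa [Matrix.mul_apply, hc, Complex.normSq_apply] using this
  have trdiag : ∀ (U : Matrix n n ℂ) (f : n → ℝ), Uᴴ * U = 1 →
      (Matrix.trace (U * diagonal (fun i => (f i : ℂ)) * Uᴴ)).re = ∑ i, f i := by
    intro U f hU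
    rw [Matrix.trace_mul_comm, ← Matrix.mul_assoc, hU, Matrix.one_mul, trace_diagonal]
    simp
  have trρ : ρ.trace.re = ∑ i, ∑ j, c i j * a i := by
    simp_rw [← Finset.sum_mul, hrow, one_mul]
    rw [V3, trdiag V a V1]
  have trσ : σ.trace.re = ∑ i, ∑ j, c i j * b j := by
    rw [Finset.sum_comm]
    simp_rw [← Finset.sum_mul, hcol, one_mul]
    rw [W3, trdiag W b W1]
  have tr1 : (Matrix.trace (ρ * mlog ρ)).re = ∑ i, ∑ j, c i j * (a i * Real.log (a i)) := by
    simp_rw [← Finset.sum_mul, hrow, one_mul]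
    have : ρ * mlog ρ = V * diagonal (fun i => ((a i * Real.log (a i) : ℝ) : ℂ)) * Vᴴ := by
      rw [V4]
      nth_rewrite 1 [V3]
      calc _ = V * diagonal (fun i => (a i : ℂ)) * (Vᴴ * V) *
            diagonal (fun i => (Real.log (a i) : ℂ)) * Vᴴ := by simp only [Matrix.mul_assoc]
        _ = _ := by
          rw [V1, Matrix.mul_one, Matrix.mul_assoc V, diagonal_mul_diagonal]
          simp
    rw [this, trdiag V _ V1]
  have tr2 : (Matrix.trace (ρ * mlog σ)).re = ∑ i, ∑ j, c i j * (a i * Real.log (b j)) := by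
    have : Matrix.trace (ρ * mlog σ) = Matrix.trace (diagonal (fun i => (a i : ℂ)) * D *
        diagonal (fun i => (Real.log (b i) : ℂ)) * Dᴴ) := by
      rw [W4]
      nth_rewrite 1 [V3]
      rw [hD, conjTranspose_mul, conjTranspose_conjTranspose]
      simp only [Matrix.mul_assoc]
      rw [Matrix.trace_mul_comm V]
      simp only [Matrix.mul_assoc]
    rw [this, Matrix.trace]
    simp only [Matrix.diag, Complex.re_sum]
    refine Finset.sum_congr rfl fun i _ => ?_
    rw [Matrix.mul_apply, Complex.re_sum]
    refine Finset.sum_congr rfl fun j _ => ?_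
    simp only [mul_diagonal, diagonal_mul, conjTranspose_apply]
    simp [hc, Complex.normSq_apply]
    ring
  have hsupp : ∀ i j, b j = 0 → c i j ≠ 0 → a i = 0 := by
    intro i j hbj hcij
    have h1 : ((Wᴴ * (σ - ρ) * W) j j).re = b j - ∑ i, c i j * a i := by
      have e : Wᴴ * (σ - ρ) * W = diagonal (fun i => (b i : ℂ)) -
          Dᴴ * diagonal (fun i => (a i : ℂ)) * D := by
        rw [V3, W3, hD, conjTranspose_mul, conjTranspose_conjTranspose]
        calc _ = (Wᴴ * W) * diagonal (fun i => (b i : ℂ)) * (Wᴴ * W) -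
              Wᴴ * V * diagonal (fun i => (a i : ℂ)) * (Vᴴ * W) := by
              simp only [Matrix.mul_sub, Matrix.sub_mul, Matrix.mul_assoc]
          _ = _ := by rw [W1]; simp
      rw [e, Matrix.sub_apply, Matrix.mul_apply]
      simp only [mul_diagonal, conjTranspose_apply, diagonal_apply_eq, Complex.sub_re,
        Complex.re_sum, Complex.ofReal_re]
      congr 1
      refine Finset.sum_congr rfl fun i _ => ?_
      simp [hc, Complex.normSq_apply]
      ring
    have h2 : 0 ≤ ((Wᴴ * (σ - ρ) * W) j j).re := by
      have := (hle.conjTranspose_mul_mul_same W).diag_nonneg (i := j)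
      exact (Complex.le_def.mp this).1
    have h3 : ∀ i, 0 ≤ c i j * a i := fun i => mul_nonneg (Complex.normSq_nonneg _) (ha i)
    have h4 := Finset.single_le_sum (fun i _ => h3 i) (Finset.mem_univ i)
    have h5 : c i j * a i = 0 := by
      have := h3 i
      linarith
    exact (mul_eq_zero.mp h5).resolve_left hcij
  have hterm : ∀ i j,
      IntervalIntegrable (fun u : ℝ => c i j * ((1 - u) *
        ((a i - b j) ^ 2 / (u * a i + (1 - u) * b j)))) MeasureTheory.volume 0 1 ∧
      ∫ u in (0 : ℝ)..1, c i j * ((1 - u) * ((a i - b j) ^ 2 / (u * a i + (1 - u) * b j)))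
        = c i j * (a i * (Real.log (a i) - Real.log (b j)) - a i + b j) := by
    intro i j
    by_cases hcij : c i j = 0
    · simp [hcij]
    · have := aux_integral (a i) (b j) (ha i) (hb j) (fun h => hsupp i j h hcij)
      exact ⟨this.1.const_mul _, by rw [intervalIntegral.integral_const_mul, this.2]⟩
  have hQ : (fun u : ℝ => (1 - u) * ∑ i, ∑ j, c i j *
      ((a i - b j) ^ 2 / (u * a i + (1 - u) * b j))) = fun u => ∑ i, ∑ j, c i j * ((1 - u) *
        ((a i - b j) ^ 2 / (u * a i + (1 - u) * b j))) := by
    ext u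
    simp only [Finset.mul_sum]
    refine Finset.sum_congr rfl fun i _ => Finset.sum_congr rfl fun j _ => ?_
    ring
  have hint1 : ∀ i, IntervalIntegrable (fun u : ℝ => ∑ j, c i j * ((1 - u) *
        ((a i - b j) ^ 2 / (u * a i + (1 - u) * b j)))) MeasureTheory.volume 0 1 := by
    intro i
    have := IntervalIntegrable.sum Finset.univ (fun j (_ : j ∈ Finset.univ) => (hterm i j).1)
    simpa only [Finset.sum_fn] using this
  refine ⟨fun u => ∑ i, ∑ j, c i j * ((a i - b j) ^ 2 / (u * a i + (1 - u) * b j)), ?_, ?_, ?_⟩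
  · rw [hQ]
    have := IntervalIntegrable.sum Finset.univ (fun i (_ : i ∈ Finset.univ) => hint1 i)
    simpa only [Finset.sum_fn] using this
  · rw [hQ, intervalIntegral.integral_finsetSum (fun i _ => hint1 i)]
    simp_rw [fun i => intervalIntegral.integral_finsetSum
      (fun j (_ : j ∈ Finset.univ) => (hterm i j).1), (hterm _ _).2]
    rw [relent, Matrix.mul_sub, Matrix.trace_sub, Complex.sub_re, Complex.sub_re, tr1, tr2,
      trρ, trσ]
    simp only [← Finset.sum_sub_distrib, ← Finset.sum_add_distrib]
    refine Finset.sum_congr rfl fun i _ => Finset.sum_congr rfl fun j _ => ?_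
    ring
  · intro u hu0 hu1
    have hden : ∀ i j, 0 ≤ u * a i + (1 - u) * b j := fun i j =>
      add_nonneg (mul_nonneg hu0.le (ha i)) (mul_nonneg (by linarith) (hb j))
    have hden0 : ∀ i j, u * a i + (1 - u) * b j = 0 → a i - b j = 0 := by
      intro i j h
      have h1 := mul_nonneg hu0.le (ha i)
      have h2 : 0 ≤ (1 - u) * b j := mul_nonneg (by linarith) (hb j)
      have h3 : u * a i = 0 := by linarith
      have h4 : (1 - u) * b j = 0 := by linarith
      have h5 := (mul_eq_zero.mp h3).resolve_left hu0.ne'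
      have h6 := (mul_eq_zero.mp h4).resolve_left (by linarith)
      rw [h5, h6, sub_zero]
    constructor
    · intro Y
      have hY : Y = V * (Vᴴ * Y * W) * Wᴴ := by
        calc Y = (V * Vᴴ) * Y * (W * Wᴴ) := by rw [V2, W2]; simp
          _ = _ := by simp only [Matrix.mul_assoc]
      rw [V3, W3, hY, auxJ_eq V W _ a b V1 W1]
      refine Finset.sum_le_sum fun i _ => Finset.sum_le_sum fun j _ => ?_
      exact aux_quad _ _ _ _ (hden i j) (hden0 i j)
    · refine ⟨V * (Matrix.of fun i j =>
        (((a i - b j) / (u * a i + (1 - u) * b j) : ℝ) : ℂ) * D i j) * Wᴴ, ?_⟩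
      rw [V3, W3, auxJ_eq V W _ a b V1 W1]
      refine Finset.sum_congr rfl fun i _ => Finset.sum_congr rfl fun j _ => ?_
      exact aux_quad_eq _ _ _

/-- partial trace over the second factor -/
def auxPtr {m k : Type*} [Fintype k] (ρ : Matrix (m × k) (m × k) ℂ) : Matrix m m ℂ :=
  Matrix.of fun x y => ∑ t, ρ (x, t) (y, t)

theorem auxPtr_trace {m k : Type*} [Fintype m] [Fintype k] [DecidableEq k]
    (ρ : Matrix (m × k) (m × k) ℂ) (Z : Matrix m m ℂ) :
    Matrix.trace ((Z ⊗ₖ (1 : Matrix k k ℂ)) * ρ) = Matrix.trace (Z * auxPtr ρ) := by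
  simp only [Matrix.trace, Matrix.diag, Matrix.mul_apply, Fintype.sum_prod_type,
    kroneckerMap_apply, auxPtr, of_apply, Finset.mul_sum]
  refine Finset.sum_congr rfl fun i _ => ?_
  rw [Finset.sum_comm]
  refine Finset.sum_congr rfl fun j _ => ?_
  simp [Matrix.one_apply]

theorem auxPtr_psd {m k : Type*} [Fintype m] [Fintype k] [DecidableEq m] [DecidableEq k]
    (ρ : Matrix (m × k) (m × k) ℂ) (h : ρ.PosSemidef) : (auxPtr ρ).PosSemidef := by
  have : auxPtr ρ = ∑ t : k, ρ.submatrix (fun x => (x, t)) (fun x => (x, t)) := by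
    ext x y
    simp [auxPtr, Matrix.sum_apply]
  rw [this]
  exact Matrix.posSemidef_sum _ fun t _ => h.submatrix _

theorem relent_mono {m k : Type*} [Fintype m] [Fintype k] [DecidableEq m] [DecidableEq k]
    (ρ σ : Matrix (m × k) (m × k) ℂ)
    (hρ : ρ.PosSemidef) (hσ : σ.PosSemidef) (hle : (σ - ρ).PosSemidef) :
    relent (auxPtr ρ) (auxPtr σ) ≤ relent ρ σ := by
  have hsub : auxPtr (σ - ρ) = auxPtr σ - auxPtr ρ := by
    ext x y; simp [auxPtr]
  have hsub' : auxPtr (ρ - σ) = auxPtr ρ - auxPtr σ := by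
    ext x y; simp [auxPtr]
  obtain ⟨Q, i1, r1, q1⟩ := relent_rep ρ σ hρ hσ hle
  obtain ⟨Q', i2, r2, q2⟩ := relent_rep (auxPtr ρ) (auxPtr σ) (auxPtr_psd _ hρ) (auxPtr_psd _ hσ)
    (hsub ▸ auxPtr_psd _ hle)
  have ht : ∀ τ : Matrix (m × k) (m × k) ℂ, (auxPtr τ).trace = τ.trace := by
    intro τ
    have := auxPtr_trace τ 1
    simpa using this.symm
  rw [r1, r2, ht, ht]
  gcongr
  apply intervalIntegral.integral_mono_on_of_le_Ioo zero_le_one i2 i1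
  intro u hu
  apply mul_le_mul_of_nonneg_left _ (by linarith [hu.2])
  obtain ⟨Y, hY⟩ := (q2 u hu.1 hu.2).2
  rw [← hY]
  refine le_trans (le_of_eq ?_) ((q1 u hu.1 hu.2).1 (Y ⊗ₖ 1))
  have hstar : (Y ⊗ₖ (1 : Matrix k k ℂ))ᴴ = Yᴴ ⊗ₖ 1 := by
    rw [conjTranspose_kronecker, conjTranspose_one]
  rw [auxJ, auxJ, hstar, auxPtr_trace, hsub']
  congr 1
  · congr 3
    rw [Matrix.trace_mul_comm, ← Matrix.mul_assoc, Matrix.trace_mul_comm _ (Y ⊗ₖ 1),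
      ← Matrix.mul_assoc, ← Matrix.mul_kronecker_mul, Matrix.mul_one, auxPtr_trace]
  · congr 2
    rw [Matrix.trace_mul_comm, ← Matrix.mul_assoc, Matrix.trace_mul_comm _ (Yᴴ ⊗ₖ 1),
      ← Matrix.mul_assoc, ← Matrix.mul_kronecker_mul, Matrix.mul_one, auxPtr_trace]

/-- Holevo-type strong subadditivity: concavity of the conditional entropy. -/
theorem ssa_cq {l m k : Type*} [Fintype l] [Fintype m] [Fintype k] [DecidableEq m] [DecidableEq k]
    (σ : l → Matrix (m × k) (m × k) ℂ) (hσ : ∀ i, (σ i).PosSemidef) :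
    ∑ i, vN (σ i) - vN (∑ i, σ i) ≤ ∑ i, vN (auxPtr (σ i)) - vN (auxPtr (∑ i, σ i)) := by
  have key : ∀ {n : Type _} [Fintype n] [DecidableEq n] (τ : l → Matrix n n ℂ),
      ∑ i, relent (τ i) (∑ j, τ j) = vN (∑ i, τ i) - ∑ i, vN (τ i) := by
    intro n _ _ τ
    simp only [relent, vN, Matrix.mul_sub, Matrix.trace_sub, Complex.sub_re,
      Finset.sum_sub_distrib]
    rw [← Complex.re_sum Finset.univ (fun i => (τ i * mlog (∑ j, τ j)).trace), ← Matrix.trace_sum,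
      ← Finset.sum_mul, Finset.sum_neg_distrib]
    ring
  have key' : ∀ (τ : l → Matrix m m ℂ),
      ∑ i, relent (τ i) (∑ j, τ j) = vN (∑ i, τ i) - ∑ i, vN (τ i) := by
    intro τ
    simp only [relent, vN, Matrix.mul_sub, Matrix.trace_sub, Complex.sub_re,
      Finset.sum_sub_distrib]
    rw [← Complex.re_sum Finset.univ (fun i => (τ i * mlog (∑ j, τ j)).trace), ← Matrix.trace_sum,
      ← Finset.sum_mul, Finset.sum_neg_distrib]
    ring
  have hp : auxPtr (∑ i, σ i) = ∑ i, auxPtr (σ i) := by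
    ext x y
    simp only [auxPtr, of_apply, Matrix.sum_apply]
    rw [Finset.sum_comm]
  have h1 := key σ
  have h2 := key' (fun i => auxPtr (σ i))
  rw [hp]
  have : ∑ i, relent (auxPtr (σ i)) (∑ j, auxPtr (σ j)) ≤ ∑ i, relent (σ i) (∑ j, σ j) := by
    refine Finset.sum_le_sum fun i _ => ?_
    rw [← hp]
    refine relent_mono _ _ (hσ i) (Matrix.posSemidef_sum _ fun j _ => hσ j) ?_
    have : ∑ j, σ j - σ i = ∑ j ∈ Finset.univ.erase i, σ j := by
      rw [← Finset.add_sum_erase _ _ (Finset.mem_univ i)]; simp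
    rw [this]
    exact Matrix.posSemidef_sum _ fun j _ => hσ j
  linarith

/-! ### The game states -/

theorem auxPtr_conj {m k : Type*} [Fintype m] [Fintype k] [DecidableEq k]
    (ρ : Matrix (m × k) (m × k) ℂ) (U : Matrix m m ℂ) :
    auxPtr ((U ⊗ₖ (1 : Matrix k k ℂ)) * ρ * (U ⊗ₖ (1 : Matrix k k ℂ))ᴴ)
      = U * auxPtr ρ * Uᴴ := by
  ext x y
  simp only [auxPtr, of_apply, Matrix.mul_apply, Fintype.sum_prod_type, kroneckerMap_apply,
    conjTranspose_apply, Matrix.one_apply, mul_ite, ite_mul, mul_one, mul_zero, zero_mul,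
    Finset.sum_ite_eq, Finset.mem_univ, if_true, apply_ite star, star_zero, Finset.sum_mul,
    Finset.mul_sum]
  rw [Finset.sum_comm]
  refine Finset.sum_congr rfl fun i _ => ?_
  rw [Finset.sum_comm]

theorem relent_pinch {n l : Type*} [Fintype n] [DecidableEq n] [Fintype l] [DecidableEq l]
    (κ ω : Matrix n n ℂ) (P : l → Matrix n n ℂ)
    (hP : ∀ i j, P i * P j = if i = j then P i else 0) (hs : ∑ i, P i = 1)
    (hω : ω.IsHermitian) (h : ω = ∑ i, P i * κ * P i) :
    relent κ ω = vN ω - vN κ := by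
  have hc : ∀ i, P i * ω = ω * P i := by
    intro i
    have h1 : P i * ω = P i * κ * P i := by
      rw [h, Finset.mul_sum]
      simp_rw [← Matrix.mul_assoc, hP]
      simp [ite_mul]
    have h2 : ω * P i = P i * κ * P i := by
      rw [h, Finset.sum_mul]
      simp_rw [Matrix.mul_assoc, hP]
      simp [mul_ite]
    rw [h1, h2]
  have hL := fun i => mlog_commute ω (P i) hω (hc i)
  have ht : Matrix.trace (ω * mlog ω) = Matrix.trace (κ * mlog ω) := by
    nth_rewrite 1 [h]
    rw [Finset.sum_mul, Matrix.trace_sum]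
    have : ∀ i, Matrix.trace (P i * κ * P i * mlog ω) = Matrix.trace (P i * (κ * mlog ω)) := by
      intro i
      rw [Matrix.mul_assoc, hL, ← Matrix.mul_assoc, Matrix.trace_mul_comm, ← Matrix.mul_assoc,
        ← Matrix.mul_assoc, hP, if_pos rfl, Matrix.mul_assoc]
    simp_rw [this]
    rw [← Matrix.trace_sum, ← Finset.sum_mul, hs, Matrix.one_mul]
  rw [relent, vN, vN, Matrix.mul_sub, Matrix.trace_sub, Complex.sub_re, ht]
  ring

theorem proj_mul {a : Type*} [Fintype a] [DecidableEq a] (g : a → a → ℂ)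
    (hg : ∀ l m, star (g l) ⬝ᵥ g m = if l = m then 1 else 0) (i j : a) :
    proj (g i) * proj (g j) = if i = j then proj (g i) else 0 := by
  rw [proj, proj, Matrix.vecMulVec_mul_vecMulVec, hg]
  split_ifs with h
  · subst h; simp
  · simp

theorem proj_herm {a : Type*} (v : a → ℂ) : (proj v)ᴴ = proj v := by
  ext i j
  simp [proj, vecMulVec_apply, mul_comm]

theorem proj_Urot {a : Type*} [Fintype a] [DecidableEq a] (g : a → a → ℂ) (gv : a → ℝ)
    (hg : ∀ l m, star (g l) ⬝ᵥ g m = if l = m then 1 else 0) (r : ℝ) (i : a) :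
    proj (g i) * Urot g gv r = Complex.exp (-(Complex.I) * (gv i) * r) • proj (g i) := by
  rw [Urot, Finset.mul_sum]
  simp_rw [Matrix.mul_smul, proj_mul g hg]
  simp [smul_ite]

theorem exp_unit (x y : ℝ) : Complex.exp (-(Complex.I) * x * y) *
    star (Complex.exp (-(Complex.I) * x * y)) = 1 := by
  rw [Complex.star_def, ← Complex.exp_conj, ← Complex.exp_add]
  simp

theorem Urot_unitary {a : Type*} [Fintype a] [DecidableEq a] (g : a → a → ℂ) (gv : a → ℝ)
    (hg : ∀ l m, star (g l) ⬝ᵥ g m = if l = m then 1 else 0)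
    (hgc : ∑ l, proj (g l) = (1 : Matrix a a ℂ)) (r : ℝ) :
    (Urot g gv r)ᴴ * Urot g gv r = 1 := by
  nth_rewrite 1 [Urot]
  rw [conjTranspose_sum, Finset.sum_mul, ← hgc]
  refine Finset.sum_congr rfl fun i _ => ?_
  rw [conjTranspose_smul, proj_herm, Matrix.smul_mul, proj_Urot g gv hg, smul_smul, mul_comm,
    exp_unit, one_smul]

theorem omega4_apply {iA iB1 iB2 iBp : Type*}
    [Fintype iA] [Fintype iB1] [Fintype iB2] [Fintype iBp]
    [DecidableEq iA] [DecidableEq iB1] [DecidableEq iB2] [DecidableEq iBp]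
    (g : iA → iA → ℂ) (ψ : (((iA × iB1) × iB2) × iBp) → ℂ) (a a' : iA) (b b' : iB1)
    (c c' : iB2) (d d' : iBp) :
    omega4 g (proj ψ) (((a, b), c), d) (((a', b'), c'), d') =
      ∑ l, g l a * star (g l a') * ((∑ x, star (g l x) * ψ (((x, b), c), d)) *
        star (∑ x, star (g l x) * ψ (((x, b'), c'), d'))) := by
  rw [omega4, Matrix.sum_apply]
  refine Finset.sum_congr rfl fun l _ => ?_
  nth_rewrite 2 [proj]
  rw [Matrix.mul_vecMulVec, Matrix.vecMulVec_mul, vecMulVec_apply]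
  simp only [Matrix.mulVec, Matrix.vecMul, dotProduct, Fintype.sum_prod_type, kroneckerMap_apply,
    Matrix.one_apply, mul_ite, ite_mul, mul_one, mul_zero, zero_mul, Finset.sum_ite_eq,
    Finset.sum_ite_eq', Finset.mem_univ, if_true, proj, vecMulVec_apply, Pi.star_apply, star_sum,
    star_mul', star_star]
  rw [Finset.sum_mul_sum, Finset.sum_mul_sum, Finset.mul_sum]
  refine Finset.sum_congr rfl fun x _ => ?_
  rw [Finset.mul_sum]
  refine Finset.sum_congr rfl fun y _ => ?_
  ring

theorem aux_swap {x y z : Type*} [Fintype x] [Fintype y] [Fintype z] (f : x → y → z → ℂ) :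
    ∑ c, ∑ d, ∑ l, f c d l = ∑ l, ∑ c, ∑ d, f c d l := by
  rw [Finset.sum_comm (s := (Finset.univ : Finset z))]
  exact Finset.sum_congr rfl fun c _ => Finset.sum_comm

/-- **Purification identity for the tripartite game** (Eqs. (39-inter) and (39)):
for a purification `ρ_{AB₁B₂B'}` of `ρ_{AB₁B₂}`, the exact identity
`S(R|AB₁)_κ + S(A|B₂B')_ω = S(R)_κ + D(κ_{AB₁}‖ω_{AB₁})` holds; consequently
`S(R|AB₁)_κ + S(A|B₂)_ω ≥ S(R)_κ + D(κ_{AB₁}‖ω_{AB₁})`, with equality iff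
`I(A:B'|B₂)_ω = 0`. -/
theorem tripartite_purification_identity
    {iR iA iB1 iB2 iBp : Type*}
    [Fintype iR] [Fintype iA] [Fintype iB1] [Fintype iB2] [Fintype iBp]
    [DecidableEq iR] [DecidableEq iA] [DecidableEq iB1] [DecidableEq iB2] [DecidableEq iBp]
    (ρ : Matrix ((iA × iB1) × iB2) ((iA × iB1) × iB2) ℂ)
    (hρ : ρ.PosSemidef) (hρtr : ρ.trace = 1)
    (ρpure : Matrix ((((iA × iB1) × iB2) × iBp)) ((((iA × iB1) × iB2) × iBp)) ℂ)
    (hpure : ∃ ψ : (((iA × iB1) × iB2) × iBp) → ℂ, star ψ ⬝ᵥ ψ = 1 ∧ ρpure = proj ψ)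
    (hmarg : redABB ρpure = ρ)
    (g : iA → iA → ℂ) (gv : iA → ℝ)
    (hg : ∀ l m, star (g l) ⬝ᵥ g m = if l = m then 1 else 0)
    (hgc : ∑ l, proj (g l) = (1 : Matrix iA iA ℂ))
    (rb : iR → iR → ℂ)
    (hrb : ∀ k m, star (rb k) ⬝ᵥ rb m = if k = m then 1 else 0)
    (hrbc : ∑ k, proj (rb k) = (1 : Matrix iR iR ℂ))
    (rv : iR → ℝ) (p : iR → ℝ) (hp : ∀ k, 0 ≤ p k) (hps : ∑ k, p k = 1) :
    ((vN (redRAB1 (kappa3 p rb rv g gv ρ)) - vN (redAB1four (kappa3 p rb rv g gv ρ)))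
        + (vN (redAB2Bp (omega4 g ρpure)) - vN (redB2Bp (omega4 g ρpure)))
      = vN (redRfour (kappa3 p rb rv g gv ρ))
        + relent (redAB1four (kappa3 p rb rv g gv ρ)) (redAB1p (omega4 g ρpure)))
    ∧ ((vN (redRAB1 (kappa3 p rb rv g gv ρ)) - vN (redAB1four (kappa3 p rb rv g gv ρ)))
        + (vN (redAB2p (omega4 g ρpure)) - vN (redB2p (omega4 g ρpure)))
      ≥ vN (redRfour (kappa3 p rb rv g gv ρ))
        + relent (redAB1four (kappa3 p rb rv g gv ρ)) (redAB1p (omega4 g ρpure)))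
    ∧ ((vN (redRAB1 (kappa3 p rb rv g gv ρ)) - vN (redAB1four (kappa3 p rb rv g gv ρ)))
        + (vN (redAB2p (omega4 g ρpure)) - vN (redB2p (omega4 g ρpure)))
      = vN (redRfour (kappa3 p rb rv g gv ρ))
        + relent (redAB1four (kappa3 p rb rv g gv ρ)) (redAB1p (omega4 g ρpure))
      ↔ vN (redAB2p (omega4 g ρpure)) + vN (redB2Bp (omega4 g ρpure))
          - vN (redAB2Bp (omega4 g ρpure)) - vN (redB2p (omega4 g ρpure)) = 0) := by
  obtain ⟨ψ, hψ, rfl⟩ := hpure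
  set ω := omega4 g (proj ψ) with hω
  set φ : iA → iB1 → iB2 → iBp → ℂ :=
    fun l b c d => ∑ x, star (g l x) * ψ (((x, b), c), d) with hφ
  set X : iA → Matrix iB1 (iB2 × iBp) ℂ := fun l => Matrix.of fun b x => φ l b x.1 x.2 with hX
  set X0 : Matrix (iA × iB1) (iB2 × iBp) ℂ := Matrix.of fun y x => ψ ((y, x.1), x.2) with hX0
  have hωa : ∀ a a' b b' c c' d d', ω (((a, b), c), d) (((a', b'), c'), d') =
      ∑ l, g l a * star (g l a') * (φ l b c d * star (φ l b' c' d')) :=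
    fun a a' b b' c c' d d' => omega4_apply g ψ a a' b b' c c' d d'
  have hgn : ∀ l, ∑ a, g l a * star (g l a) = 1 := by
    intro l
    have := hg l l
    simp only [dotProduct, Pi.star_apply, if_true] at this
    rw [← this]
    exact Finset.sum_congr rfl fun a _ => mul_comm _ _
  have hrbn : ∀ l, ∑ a, rb l a * star (rb l a) = 1 := by
    intro l
    have := hrb l l
    simp only [dotProduct, Pi.star_apply, if_true] at this
    rw [← this]
    exact Finset.sum_congr rfl fun a _ => mul_comm _ _
  have hgce : ∀ a a', ∑ l, g l a * star (g l a') = if a = a' then 1 else 0 := by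
    intro a a'
    have := congrFun (congrFun hgc a) a'
    simpa [Matrix.sum_apply, proj, vecMulVec_apply, Matrix.one_apply] using this
  have hg' : ∀ l m, star (g l) ⬝ᵥ g m = if l = m then 1 else 0 := by
    intro l m; rw [hg]
  have hrb' : ∀ l m, star (rb l) ⬝ᵥ rb m = if l = m then 1 else 0 := by
    intro l m; rw [hrb]
  -- entropies of the reduced states of `ω`
  have H1 : vN (redAB1p ω) = ∑ l, vN (X l * (X l)ᴴ) := by
    refine vN_cq (Equiv.refl _) g hg' _
      (fun l => Matrix.isHermitian_mul_conjTranspose_self _) _ ?_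
    rintro ⟨a, b⟩ ⟨a', b'⟩
    simp only [redAB1p, of_apply, hωa, Equiv.refl_apply, Matrix.mul_apply, conjTranspose_apply, hX,
      Fintype.sum_prod_type, Finset.mul_sum]
    exact aux_swap _
  have H2 : vN (redAB2Bp ω) = ∑ l, vN ((X l)ᵀ * ((X l)ᵀ)ᴴ) := by
    refine vN_cq (Equiv.prodAssoc _ _ _) g hg' _
      (fun l => Matrix.isHermitian_mul_conjTranspose_self _) _ ?_
    rintro ⟨⟨a, c⟩, d⟩ ⟨⟨a', c'⟩, d'⟩
    simp only [redAB2Bp, of_apply, hωa, Equiv.prodAssoc_apply, Matrix.mul_apply, transpose_apply,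
      conjTranspose_apply, hX, Finset.mul_sum]
    rw [Finset.sum_comm]
  have H4 : vN (redAB2p ω) = ∑ l, vN (auxPtr ((X l)ᵀ * ((X l)ᵀ)ᴴ)) := by
    refine vN_cq (Equiv.refl _) g hg' _
      (fun l => (auxPtr_psd _ (Matrix.posSemidef_self_mul_conjTranspose _)).1) _ ?_
    rintro ⟨a, c⟩ ⟨a', c'⟩
    simp only [redAB2p, of_apply, hωa, Equiv.refl_apply, Matrix.mul_apply, transpose_apply,
      conjTranspose_apply, hX, Finset.mul_sum, auxPtr]
    rw [aux_swap]
    exact Finset.sum_congr rfl fun l _ => Finset.sum_comm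
  have hred : ∀ c c' d d', ∑ a : iA × iB1, ω ((a, c), d) ((a, c'), d') =
      ∑ l, ∑ b, φ l b c d * star (φ l b c' d') := by
    intro c c' d d'
    simp only [Fintype.sum_prod_type, hωa]
    calc _ = ∑ a, ∑ l, ∑ b, g l a * star (g l a) * (φ l b c d * star (φ l b c' d')) :=
          Finset.sum_congr rfl fun a _ => Finset.sum_comm
      _ = ∑ l, ∑ a, ∑ b, g l a * star (g l a) * (φ l b c d * star (φ l b c' d')) :=
          Finset.sum_comm
      _ = _ := by
          refine Finset.sum_congr rfl fun l _ => ?_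
          rw [← Finset.sum_mul_sum, hgn, one_mul]
  have H3 : redB2Bp ω = ∑ l, (X l)ᵀ * ((X l)ᵀ)ᴴ := by
    ext ⟨c, d⟩ ⟨c', d'⟩
    simp only [redB2Bp, of_apply, hred, Matrix.sum_apply, Matrix.mul_apply, transpose_apply,
      conjTranspose_apply, hX]
  have H5 : redB2p ω = auxPtr (∑ l, (X l)ᵀ * ((X l)ᵀ)ᴴ) := by
    rw [← H3]
    ext c c'
    simp only [redB2p, of_apply, auxPtr, redB2Bp]
    rw [Finset.sum_comm]
  have H6' : redB2Bp ω = X0ᵀ * (X0ᵀ)ᴴ := by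
    ext ⟨c, d⟩ ⟨c', d'⟩
    simp only [redB2Bp, of_apply, hred, Matrix.mul_apply, transpose_apply,
      conjTranspose_apply, hX0, Fintype.sum_prod_type]
    have : ∀ b, ∑ l, φ l b c d * star (φ l b c' d') =
        ∑ a, ψ (((a, b), c), d) * star (ψ (((a, b), c'), d')) := by
      intro b
      calc _ = ∑ l, ∑ x, ∑ y, (g l y * star (g l x)) *
            (ψ (((x, b), c), d) * star (ψ (((y, b), c'), d'))) := by
            refine Finset.sum_congr rfl fun l _ => ?_
            simp only [hφ, star_sum, star_mul', star_star]
            rw [Finset.sum_mul_sum]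
            refine Finset.sum_congr rfl fun x _ => Finset.sum_congr rfl fun y _ => ?_
            ring
        _ = ∑ x, ∑ y, (∑ l, g l y * star (g l x)) *
            (ψ (((x, b), c), d) * star (ψ (((y, b), c'), d'))) := by
            rw [Finset.sum_comm]
            refine Finset.sum_congr rfl fun x _ => ?_
            rw [Finset.sum_comm]
            refine Finset.sum_congr rfl fun y _ => ?_
            rw [Finset.sum_mul]
        _ = _ := by
            simp_rw [hgce]
            simp
    rw [Finset.sum_comm]
    simp_rw [this]
    rw [Finset.sum_comm]
  set ρ1 := redAB1 ρ with hρ1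
  have hρ1X : ρ1 = X0 * X0ᴴ := by
    rw [hρ1, ← hmarg]
    ext x y
    simp [redAB1, redABB, hX0, Matrix.mul_apply, Fintype.sum_prod_type, proj, vecMulVec_apply]
  have hρ1ptr : ρ1 = auxPtr ρ := rfl
  have hρ1H : ρ1.IsHermitian := by
    rw [hρ1X]; exact Matrix.isHermitian_mul_conjTranspose_self _
  have hρ1tr : ρ1.trace = 1 := by
    have := auxPtr_trace ρ 1
    rw [← hρtr, hρ1ptr]
    simpa using this.symm
  have H6 : vN (redB2Bp ω) = vN ρ1 := by
    rw [H6', hρ1X]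
    exact (vN_purity X0).symm
  have H7 : vN (redAB2Bp ω) = vN (redAB1p ω) := by
    rw [H1, H2]
    exact Finset.sum_congr rfl fun l _ => (vN_purity _).symm
  -- the state `κ`
  set U : iR → Matrix (iA × iB1) (iA × iB1) ℂ :=
    fun k => Urot g gv (rv k) ⊗ₖ (1 : Matrix iB1 iB1 ℂ) with hU
  have hUU : ∀ k, (U k)ᴴ * U k = 1 := by
    intro k
    rw [hU, conjTranspose_kronecker, ← Matrix.mul_kronecker_mul, Urot_unitary g gv hg' hgc]
    simp
  set κ := kappa3 p rb rv g gv ρ with hκ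
  have hκa : ∀ r r' x y, κ (r, x) (r', y) = ∑ k, rb k r * star (rb k r') *
      ((p k : ℂ) * ((U k ⊗ₖ (1 : Matrix iB2 iB2 ℂ)) * ρ *
        (U k ⊗ₖ (1 : Matrix iB2 iB2 ℂ))ᴴ) x y) := by
    intro r r' x y
    rw [hκ, kappa3, Matrix.sum_apply]
    refine Finset.sum_congr rfl fun k _ => ?_
    rw [Matrix.smul_apply, kroneckerMap_apply, smul_eq_mul, proj, vecMulVec_apply, UA3,
      Pi.star_apply]
    ring
  have hptr : ∀ k x y, ∑ t, ((U k ⊗ₖ (1 : Matrix iB2 iB2 ℂ)) * ρ *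
        (U k ⊗ₖ (1 : Matrix iB2 iB2 ℂ))ᴴ) (x, t) (y, t) = (U k * ρ1 * (U k)ᴴ) x y := by
    intro k x y
    rw [hρ1ptr, ← auxPtr_conj]
    rfl
  have K1 : vN (redRAB1 κ) = vN ρ1 + ∑ k, Real.negMulLog (p k) := by
    rw [vN_cq (Equiv.refl _) rb hrb' (fun k => (p k : ℂ) • (U k * ρ1 * (U k)ᴴ))]
    · simp_rw [vN_smul_conj ρ1 _ hρ1H (hUU _), hρ1tr, Finset.sum_add_distrib, ← Finset.sum_mul,
        hps]
      simp
    · intro k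
      have := Matrix.isHermitian_mul_mul_conjTranspose (U k) hρ1H
      rw [Matrix.IsHermitian, conjTranspose_smul, this.eq]
      simp
    · rintro ⟨r, x⟩ ⟨r', y⟩
      simp only [redRAB1, of_apply, hκa, Equiv.refl_apply, Matrix.smul_apply, smul_eq_mul]
      rw [Finset.sum_comm]
      refine Finset.sum_congr rfl fun k _ => ?_
      rw [← Finset.mul_sum, ← Finset.mul_sum, hptr]
  have hUtr : ∀ k, Matrix.trace (U k * ρ1 * (U k)ᴴ) = 1 := by
    intro k
    rw [Matrix.trace_mul_comm, ← Matrix.mul_assoc, hUU, Matrix.one_mul, hρ1tr]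
  have K2 : vN (redRfour κ) = ∑ k, Real.negMulLog (p k) := by
    apply vN_of_isometry _ (Matrix.of fun r k => rb k r)
    · ext k k'
      have := hrb' k k'
      simp only [dotProduct, Pi.star_apply] at this
      rw [Matrix.mul_apply, Matrix.one_apply, ← this]
      rfl
    · ext r r'
      simp only [redRfour, of_apply, hκa]
      rw [Finset.sum_comm, Matrix.mul_apply]
      refine Finset.sum_congr rfl fun k _ => ?_
      rw [← Finset.mul_sum, ← Finset.mul_sum, Fintype.sum_prod_type]
      simp_rw [hptr]
      have := hUtr k
      rw [Matrix.trace] at this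
      simp only [Matrix.diag] at this
      rw [this, mul_diagonal, conjTranspose_apply, of_apply, of_apply]
      ring
  have K3 : redAB1four κ = ∑ k, (p k : ℂ) • (U k * ρ1 * (U k)ᴴ) := by
    ext x y
    simp only [redAB1four, of_apply, hκa, Matrix.sum_apply, Matrix.smul_apply, smul_eq_mul]
    calc _ = ∑ r, ∑ k, rb k r * star (rb k r) * ((p k : ℂ) * (U k * ρ1 * (U k)ᴴ) x y) := by
          refine Finset.sum_congr rfl fun r _ => ?_
          rw [Finset.sum_comm]
          refine Finset.sum_congr rfl fun k _ => ?_
          rw [← Finset.mul_sum, ← Finset.mul_sum, hptr]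
      _ = _ := by
          rw [Finset.sum_comm]
          refine Finset.sum_congr rfl fun k _ => ?_
          rw [← Finset.sum_mul, hrbn, one_mul]
  -- pinching
  set P : iA → Matrix (iA × iB1) (iA × iB1) ℂ :=
    fun l => proj (g l) ⊗ₖ (1 : Matrix iB1 iB1 ℂ) with hP
  have hPP : ∀ i j, P i * P j = if i = j then P i else 0 := by
    intro i j
    rw [hP]
    simp only
    rw [← Matrix.mul_kronecker_mul, proj_mul g hg', Matrix.mul_one]
    split_ifs <;> simp
  have hPs : ∑ l, P l = 1 := by
    have : ∑ l, P l = (∑ l, proj (g l)) ⊗ₖ (1 : Matrix iB1 iB1 ℂ) := by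
      ext ⟨a, b⟩ ⟨a', b'⟩
      simp only [hP, Matrix.sum_apply, kroneckerMap_apply, Finset.sum_mul]
    rw [this, hgc, Matrix.one_kronecker_one]
  have hPh : ∀ l, (P l)ᴴ = P l := by
    intro l
    rw [hP, conjTranspose_kronecker, proj_herm, conjTranspose_one]
  have hPU : ∀ l k, P l * U k = Complex.exp (-(Complex.I) * (gv l) * (rv k)) • P l := by
    intro l k
    rw [hP, hU]
    simp only
    rw [← Matrix.mul_kronecker_mul, proj_Urot g gv hg', Matrix.mul_one, Matrix.smul_kronecker]
  have hPκ : ∀ l, P l * redAB1four κ * P l = P l * ρ1 * P l := by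
    intro l
    have h1 : ∀ k, P l * (U k * ρ1 * (U k)ᴴ) * P l = P l * ρ1 * P l := by
      intro k
      have h2 : (U k)ᴴ * P l = star (Complex.exp (-(Complex.I) * (gv l) * (rv k))) • P l := by
        have := congrArg conjTranspose (hPU l k)
        rwa [conjTranspose_mul, conjTranspose_smul, hPh] at this
      calc _ = (P l * U k) * ρ1 * ((U k)ᴴ * P l) := by simp only [Matrix.mul_assoc]
        _ = _ := by
          rw [hPU, h2, Matrix.smul_mul, Matrix.smul_mul, Matrix.mul_smul, smul_smul, exp_unit,
            one_smul]
    rw [K3, Finset.mul_sum, Finset.sum_mul]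
    simp_rw [Matrix.mul_smul, Matrix.smul_mul, h1]
    rw [← Finset.sum_smul]
    have : ∑ k, (p k : ℂ) = 1 := by exact_mod_cast hps
    rw [this, one_smul]
  have hω1 : redAB1p ω = ∑ l, P l * ρ1 * P l := by
    have hPX : ∀ l a b x, (P l * X0) (a, b) x = g l a * φ l b x.1 x.2 := by
      intro l a b x
      simp only [hP, hX0, Matrix.mul_apply, Fintype.sum_prod_type, kroneckerMap_apply, of_apply,
        Matrix.one_apply, mul_ite, ite_mul, mul_one, mul_zero, zero_mul, Finset.sum_ite_eq,
        Finset.mem_univ, if_true, proj, vecMulVec_apply, Pi.star_apply, hφ, Finset.mul_sum]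
      exact Finset.sum_congr rfl fun _ _ => by ring
    have h1 : ∀ l, P l * ρ1 * P l = (P l * X0) * (P l * X0)ᴴ := by
      intro l
      rw [hρ1X, conjTranspose_mul, hPh]
      simp only [Matrix.mul_assoc]
    simp_rw [h1]
    ext ⟨a, b⟩ ⟨a', b'⟩
    simp only [redAB1p, of_apply, Matrix.sum_apply, Matrix.mul_apply (M := P _ * X0),
      conjTranspose_apply, hPX, hωa]
    rw [aux_swap]
    refine Finset.sum_congr rfl fun l _ => ?_
    rw [Fintype.sum_prod_type]
    refine Finset.sum_congr rfl fun c _ => Finset.sum_congr rfl fun d _ => ?_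
    rw [star_mul']
    ring
  have hωH : (redAB1p ω).IsHermitian := by
    rw [hω1, Matrix.IsHermitian, conjTranspose_sum]
    refine Finset.sum_congr rfl fun l _ => ?_
    rw [conjTranspose_mul, conjTranspose_mul, hPh, hρ1H.eq, Matrix.mul_assoc]
  have K4 : relent (redAB1four κ) (redAB1p ω) = vN (redAB1p ω) - vN (redAB1four κ) := by
    apply relent_pinch _ _ P hPP hPs hωH
    rw [hω1]
    exact Finset.sum_congr rfl fun l _ => (hPκ l).symm
  have SSA : vN (redAB2Bp ω) - vN (redB2Bp ω) ≤ vN (redAB2p ω) - vN (redB2p ω) := by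
    have := ssa_cq (fun l => (X l)ᵀ * ((X l)ᵀ)ᴴ)
      (fun l => Matrix.posSemidef_self_mul_conjTranspose _)
    rw [H2, H3, H4, H5]
    exact this
  refine ⟨?_, ?_, ?_, ?_⟩
  · rw [K1, K2, K4, H6, H7]; ring
  · rw [K1, K2, K4]
    rw [H6, H7] at SSA
    linarith
  · intro h
    rw [K1, K2, K4] at h
    rw [H6, H7]
    linarith
  · intro h
    rw [H6, H7] at h
    rw [K1, K2, K4]
    linarith
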